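/- arXiv:2309.08719 — 3 statements merged into one kernel-verified Lean document; each statement's English description precedes it below -/
import Mathlib

section
/- Let G be a context-free grammar with total alphabet V, let W ⊆ V, and let F ⊆ W* be a regular language. Then the language of G finalized by F, L(G,F), is context-free. -/
/- The weak identity from `V*` to `W*`: keeps symbols of `W`, erases all others. -/
open scoped Classical in
noncomputable def projOn {α : Type*} (W : Set α) (y : List α) : List α :=
  y.filter (fun a => decide (a ∈ W))

/-- Erase all nonterminals, keeping the terminal string. -/
def projT {T N : Type*} (y : List (Symbol T N)) : List T :=
  y.filterMap (fun s => match s with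
    | Symbol.terminal t => some t
    | Symbol.nonterminal _ => none)

/-- The language of a context-free grammar `G` finalized by a final language `F`
over the subalphabet `W` of the total alphabet of `G`:  `L(G,F)` consists of the
terminal strings obtained from sentential forms `y` of `G` such that the projection
of `y` onto `W` belongs to `F` and every symbol of `y` lies in `W ∪ T`. -/
noncomputable def finalizedLanguage {T : Type*} (G : ContextFreeGrammar T)
    (W : Set (Symbol T G.NT)) (F : Language (Symbol T G.NT)) : Language T :=
  { x | ∃ y : List (Symbol T G.NT),
      G.Derives [Symbol.nonterminal G.initial] y ∧
      projOn W y ∈ F ∧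
      (∀ s ∈ y, s ∈ W ∨ ∃ t, s = Symbol.terminal t) ∧
      x = projT y }

namespace ContextFreeGrammar

section Transduction

variable {T σ : Type} (G : ContextFreeGrammar T) (M : DFA (Symbol T G.NT) σ)
  (K : Set (Symbol T G.NT)) (out : Symbol T G.NT → List T)

/-- Nonterminals of the triple construction: a fresh initial symbol, and the triples `(p, s, q)`
standing for a part of a derivation that starts from `s` and leads the automaton from `p` to
`q`. -/
abbrev TripleNT (σ : Type) : Type := Option (σ × Symbol T G.NT × σ)

/-- `G.TriplePath p w z q`: the string `z` of triples annotates `w` by a sequence of states leading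
from `p` to `q`. -/
inductive TriplePath : σ → List (Symbol T G.NT) → List (Symbol T (G.TripleNT σ)) → σ → Prop
  | nil (p : σ) : TriplePath p [] [] p
  | cons (p : σ) {q r : σ} (s : Symbol T G.NT) {w : List (Symbol T G.NT)}
      {z : List (Symbol T (G.TripleNT σ))} (h : TriplePath q w z r) :
      TriplePath p (s :: w) (.nonterminal (some (p, s, q)) :: z) r

/-- `G.TripleMatch M K out p w z q`: the string `z` annotates `w` by a sequence of states leading
from `p` to `q`, where some symbols of `w` lying in `K` have been read by the automaton `M` and
replaced by their output. -/
inductive TripleMatch : σ → List (Symbol T G.NT) → List (Symbol T (G.TripleNT σ)) → σ → Prop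
  | nil (p : σ) : TripleMatch p [] [] p
  | triple (p : σ) {q r : σ} (s : Symbol T G.NT) {w : List (Symbol T G.NT)}
      {z : List (Symbol T (G.TripleNT σ))} (h : TripleMatch q w z r) :
      TripleMatch p (s :: w) (.nonterminal (some (p, s, q)) :: z) r
  | output (p : σ) {r : σ} (s : Symbol T G.NT) {w : List (Symbol T G.NT)}
      {z : List (Symbol T (G.TripleNT σ))} (hs : s ∈ K) (h : TripleMatch (M.step p s) w z r) :
      TripleMatch p (s :: w) ((out s).map .terminal ++ z) r

/-- The symbols that may occur in sentential forms of `G`. -/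
def relevantSymbols : Set (Symbol T G.NT) :=
  {s | s = .nonterminal G.initial ∨ ∃ r ∈ G.rules, s ∈ r.output}

/-- Rules of the triple construction. -/
def tripleRules : Set (ContextFreeRule T (G.TripleNT σ)) :=
  {r | ∃ f ∈ M.accept,
    r = ⟨none, [.nonterminal (some (M.start, .nonterminal G.initial, f))]⟩} ∪
  {r | ∃ r₀ ∈ G.rules, ∃ p q z, G.TriplePath p r₀.output z q ∧
    r = ⟨some (p, .nonterminal r₀.input, q), z⟩} ∪
  {r | ∃ s ∈ G.relevantSymbols, ∃ p, s ∈ K ∧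
    r = ⟨some (p, s, M.step p s), (out s).map .terminal⟩}

variable {G M K out}

lemma TriplePath.split {w₁ w₂ : List (Symbol T G.NT)} {p r : σ}
    {z : List (Symbol T (G.TripleNT σ))} (h : G.TriplePath p (w₁ ++ w₂) z r) :
    ∃ q z₁ z₂, G.TriplePath p w₁ z₁ q ∧ G.TriplePath q w₂ z₂ r ∧ z = z₁ ++ z₂ := by
  induction w₁ generalizing p z with
  | nil => exact ⟨p, [], z, .nil p, h, rfl⟩
  | cons s w₁ ih =>
    cases h with
    | cons _ _ h =>
      obtain ⟨q, z₁, z₂, h₁, h₂, rfl⟩ := ih h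
      exact ⟨q, _, z₂, .cons p s h₁, h₂, rfl⟩

lemma TriplePath.append {w₁ w₂ : List (Symbol T G.NT)} {p q r : σ}
    {z₁ z₂ : List (Symbol T (G.TripleNT σ))} (h₁ : G.TriplePath p w₁ z₁ q)
    (h₂ : G.TriplePath q w₂ z₂ r) : G.TriplePath p (w₁ ++ w₂) (z₁ ++ z₂) r := by
  induction h₁ with
  | nil => exact h₂
  | cons p s _ ih => exact .cons p s (ih h₂)

lemma TriplePath.tripleMatch {w : List (Symbol T G.NT)} {p q : σ}
    {z : List (Symbol T (G.TripleNT σ))} (h : G.TriplePath p w z q) :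
    G.TripleMatch M K out p w z q := by
  induction h with
  | nil p => exact .nil p
  | cons p s _ ih => exact .triple p s ih

lemma finite_triplePath [Finite σ] (w : List (Symbol T G.NT)) (p : σ) :
    {z | ∃ r, G.TriplePath p w z r}.Finite := by
  induction w generalizing p with
  | nil =>
    refine (Set.finite_singleton []).subset ?_
    rintro z ⟨r, h⟩
    cases h
    rfl
  | cons s w ih =>
    refine (Set.finite_iUnion fun q => (ih q).image
      (List.cons (Symbol.nonterminal (some (p, s, q))))).subset ?_
    rintro z ⟨r, h⟩
    cases h with
    | cons _ _ h => exact Set.mem_iUnion.2 ⟨_, _, ⟨r, h⟩, rfl⟩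

lemma TripleMatch.append {w₁ w₂ : List (Symbol T G.NT)} {p q r : σ}
    {z₁ z₂ : List (Symbol T (G.TripleNT σ))} (h₁ : G.TripleMatch M K out p w₁ z₁ q)
    (h₂ : G.TripleMatch M K out q w₂ z₂ r) :
    G.TripleMatch M K out p (w₁ ++ w₂) (z₁ ++ z₂) r := by
  induction h₁ with
  | nil => exact h₂
  | triple p s _ ih => exact .triple p s (ih h₂)
  | output p s hs _ ih =>
    rw [List.append_assoc]
    exact .output p s hs (ih h₂)

lemma TripleMatch.split_nonterminal {w : List (Symbol T G.NT)} {p q p' q' : σ}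
    {s : Symbol T G.NT} {z : List (Symbol T (G.TripleNT σ))}
    (h : G.TripleMatch M K out p w z q) {a b : List (Symbol T (G.TripleNT σ))}
    (hz : z = a ++ [.nonterminal (some (p', s, q'))] ++ b) :
    ∃ w₁ w₂, w = w₁ ++ [s] ++ w₂ ∧ G.TripleMatch M K out p w₁ a p' ∧
      G.TripleMatch M K out q' w₂ b q := by
  induction h generalizing a with
  | nil => simp at hz
  | @triple p q₁ r s₁ w z h ih =>
    cases a with
    | nil =>
      simp only [List.nil_append, List.cons_append, List.cons.injEq, Symbol.nonterminal.injEq,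
        Option.some.injEq, Prod.mk.injEq] at hz
      obtain ⟨⟨rfl, rfl, rfl⟩, rfl⟩ := hz
      exact ⟨[], w, rfl, .nil _, h⟩
    | cons x a =>
      simp only [List.cons_append, List.cons.injEq] at hz
      obtain ⟨rfl, hz⟩ := hz
      obtain ⟨w₁, w₂, rfl, h₁, h₂⟩ := ih hz
      exact ⟨s₁ :: w₁, w₂, rfl, .triple p s₁ h₁, h₂⟩
  | @output p r s₁ w z hs h ih =>
    rw [List.append_assoc, List.append_eq_append_iff] at hz
    obtain ⟨a', rfl, hz⟩ | ⟨c, hc, hz⟩ := hz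
    · rw [← List.append_assoc] at hz
      obtain ⟨w₁, w₂, rfl, h₁, h₂⟩ := ih hz
      exact ⟨s₁ :: w₁, w₂, rfl, .output p s₁ hs h₁, h₂⟩
    · cases c with
      | nil =>
        obtain ⟨w₁, w₂, rfl, h₁, h₂⟩ := ih (a := []) (by simpa using hz.symm)
        have h₃ := TripleMatch.output p s₁ hs h₁
        rw [hc, List.append_nil, List.append_nil] at h₃
        exact ⟨s₁ :: w₁, w₂, rfl, h₃, h₂⟩
      | cons x c =>
        simp only [List.cons_append, List.nil_append, List.cons.injEq] at hz
        have : x ∈ (out s₁).map Symbol.terminal := by simp [hc]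
        simp [← hz.1] at this

lemma TripleMatch.of_terminals {w : List (Symbol T G.NT)} {p q : σ}
    {z : List (Symbol T (G.TripleNT σ))} (h : G.TripleMatch M K out p w z q) {x : List T}
    (hz : z = x.map .terminal) :
    (∀ s ∈ w, s ∈ K) ∧ M.evalFrom p w = q ∧ x = w.flatMap out := by
  induction h generalizing x with
  | nil => simpa using hz.symm
  | triple => cases x <;> simp at hz
  | output p s hs h ih =>
    obtain ⟨x₁, x₂, rfl, h₁, h₂⟩ := List.append_eq_map_iff.1 hz
    obtain ⟨hK, hq, rfl⟩ := ih h₂.symm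
    have hinj : Function.Injective (Symbol.terminal : T → Symbol T (G.TripleNT σ)) :=
      fun _ _ h => by simpa using h
    have := hinj.list_map h₁
    subst this
    simp [hs, hq]
    exact hK

lemma finite_relevantSymbols : G.relevantSymbols.Finite := by
  have h : (⋃ r ∈ G.rules, {s | s ∈ r.output}).Finite :=
    G.rules.finite_toSet.biUnion fun r _ => List.finite_toSet r.output
  refine (h.insert (.nonterminal G.initial)).subset ?_
  rintro s (rfl | ⟨r, hr, hs⟩)
  · exact .inl rfl
  · exact .inr (by simpa using ⟨r, hr, hs⟩)

lemma finite_tripleRules [Finite σ] : (G.tripleRules M K out).Finite := by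
  refine .union (.union ?_ ?_) ?_
  · refine (Set.finite_range fun f : σ => (⟨none, [.nonterminal (some (M.start,
      .nonterminal G.initial, f))]⟩ : ContextFreeRule T (G.TripleNT σ))).subset ?_
    rintro r ⟨f, -, rfl⟩
    exact ⟨f, rfl⟩
  · refine (G.rules.finite_toSet.biUnion fun r₀ _ => Set.finite_iUnion fun p : σ =>
      Set.finite_iUnion fun q : σ => (finite_triplePath r₀.output p).image fun z =>
        (⟨some (p, .nonterminal r₀.input, q), z⟩ : ContextFreeRule T (G.TripleNT σ))).subset ?_
    rintro r ⟨r₀, hr, p, q, z, hz, rfl⟩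
    simp only [Set.mem_iUnion]
    exact ⟨r₀, hr, p, q, z, ⟨q, hz⟩, rfl⟩
  · refine (finite_relevantSymbols.biUnion fun s _ => Set.finite_range fun p : σ =>
      (⟨some (p, s, M.step p s), (out s).map .terminal⟩ :
        ContextFreeRule T (G.TripleNT σ))).subset ?_
    rintro r ⟨s, hs, p, -, rfl⟩
    simp only [Set.mem_iUnion]
    exact ⟨s, hs, p, rfl⟩

variable (G M K out) in
/-- The grammar generating the outputs of the sentential forms of `G` that consist of symbols
of `K` and are accepted by `M`. -/
noncomputable def tripleGrammar [Finite σ] : ContextFreeGrammar T where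
  NT := G.TripleNT σ
  initial := none
  rules := (finite_tripleRules (G := G) (M := M) (K := K) (out := out)).toFinset

variable [Finite σ]

lemma produces_tripleGrammar_iff {u v : List (Symbol T (G.TripleNT σ))} :
    (G.tripleGrammar M K out).Produces u v ↔
      ∃ r ∈ G.tripleRules M K out, r.Rewrites u v := by
  refine exists_congr fun r => and_congr_left fun _ => ?_
  exact Set.Finite.mem_toFinset (finite_tripleRules (G := G) (M := M) (K := K) (out := out))

lemma exists_tripleMatch_of_derives {p q : σ} {z : List (Symbol T (G.TripleNT σ))}
    (h : (G.tripleGrammar M K out).Derives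
      [.nonterminal (some (p, .nonterminal G.initial, q))] z) :
    ∃ y, G.Derives [.nonterminal G.initial] y ∧ G.TripleMatch M K out p y z q := by
  induction h with
  | refl => exact ⟨_, .refl _, .triple p _ (.nil q)⟩
  | tail _ hp ih =>
    obtain ⟨y, hy, hm⟩ := ih
    obtain ⟨r, hr, hrw⟩ := produces_tripleGrammar_iff.1 hp
    obtain ⟨a, b, ha, hb⟩ := hrw.exists_parts
    subst hb
    obtain (⟨f, -, rfl⟩ | ⟨r₀, hr₀, p', q', z, hz, rfl⟩) | ⟨s, -, p', hs, rfl⟩ := hr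
    · exfalso
      subst ha
      clear hp hrw
      have key : ∀ {p w z q}, G.TripleMatch M K out p w z q →
          (Symbol.nonterminal none : Symbol T (G.TripleNT σ)) ∉ z := by
        intro p w z q h
        induction h <;> simp_all
      exact key hm (by simp)
    · obtain ⟨w₁, w₂, rfl, h₁, h₂⟩ := hm.split_nonterminal ha
      exact ⟨_, hy.trans_produces ⟨r₀, hr₀, r₀.rewrites_of_exists_parts w₁ w₂⟩,
        (h₁.append hz.tripleMatch).append h₂⟩
    · obtain ⟨w₁, w₂, rfl, h₁, h₂⟩ := hm.split_nonterminal ha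
      refine ⟨_, hy, (h₁.append ?_).append h₂⟩
      simpa using TripleMatch.output p' s hs (.nil _)

lemma derives_of_triplePath {y : List (Symbol T G.NT)}
    (h : G.Derives [.nonterminal G.initial] y) {p q : σ}
    {z : List (Symbol T (G.TripleNT σ))} (hz : G.TriplePath p y z q) :
    (G.tripleGrammar M K out).Derives
      [.nonterminal (some (p, .nonterminal G.initial, q))] z := by
  induction h generalizing z with
  | refl =>
    cases hz with
    | cons _ _ h =>
      cases h
      exact Relation.ReflTransGen.refl
  | tail _ hp ih =>
    obtain ⟨r, hr, hrw⟩ := hp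
    obtain ⟨a, b, rfl, rfl⟩ := hrw.exists_parts
    obtain ⟨q₂, z₁₂, z₃, h₁₂, h₃, rfl⟩ := hz.split
    obtain ⟨q₁, z₁, z₂, h₁, h₂, rfl⟩ := h₁₂.split
    have := ih ((h₁.append (.cons q₁ (.nonterminal r.input) (.nil q₂))).append h₃)
    refine this.trans_produces (produces_tripleGrammar_iff.2
      ⟨⟨some (q₁, .nonterminal r.input, q₂), z₂⟩, .inl (.inr ⟨r, hr, q₁, q₂, z₂, h₂, rfl⟩), ?_⟩)
    exact ContextFreeRule.rewrites_of_exists_parts _ z₁ z₃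

lemma mem_relevantSymbols_of_derives {y : List (Symbol T G.NT)}
    (h : G.Derives [.nonterminal G.initial] y) : ∀ s ∈ y, s ∈ G.relevantSymbols := by
  induction h with
  | refl => simp [relevantSymbols]
  | tail _ hp ih =>
    obtain ⟨r, hr, hrw⟩ := hp
    obtain ⟨a, b, rfl, rfl⟩ := hrw.exists_parts
    intro s hs
    simp only [List.mem_append] at hs ih
    obtain (hs | hs) | hs := hs
    · exact ih s (.inl (.inl hs))
    · exact .inr ⟨r, hr, hs⟩
    · exact ih s (.inr hs)

lemma exists_triplePath_derives_output (p : σ) (y : List (Symbol T G.NT))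
    (hK : ∀ s ∈ y, s ∈ K) (hR : ∀ s ∈ y, s ∈ G.relevantSymbols) :
    ∃ z, G.TriplePath p y z (M.evalFrom p y) ∧
      (G.tripleGrammar M K out).Derives z ((y.flatMap out).map .terminal) := by
  induction y generalizing p with
  | nil => exact ⟨[], .nil p, Relation.ReflTransGen.refl⟩
  | cons s y ih =>
    simp only [List.forall_mem_cons] at hK hR
    obtain ⟨z, hz, hd⟩ := ih (M.step p s) hK.2 hR.2
    refine ⟨_, .cons p s hz, ?_⟩
    have hp : (G.tripleGrammar M K out).Produces (.nonterminal (some (p, s, M.step p s)) :: z)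
        ((out s).map .terminal ++ z) :=
      produces_tripleGrammar_iff.2 ⟨⟨some (p, s, M.step p s), (out s).map .terminal⟩,
        .inr ⟨s, hR.1, p, hK.1, rfl⟩, .head z⟩
    rw [List.flatMap_cons, List.map_append]
    exact hp.trans_derives (hd.append_left _)

theorem mem_language_tripleGrammar_iff {x : List T} :
    x ∈ (G.tripleGrammar M K out).language ↔
      ∃ y, G.Derives [.nonterminal G.initial] y ∧ y ∈ M.accepts ∧ (∀ s ∈ y, s ∈ K) ∧
        x = y.flatMap out := by
  rw [mem_language_iff]
  constructor
  · intro h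
    obtain h | ⟨v, hp, hd⟩ := h.eq_or_head
    · cases x <;> simp at h
    · obtain ⟨r, hr, hrw⟩ := produces_tripleGrammar_iff.1 hp
      have hin : r.input = none :=
        Symbol.nonterminal.inj (List.mem_singleton.1 hrw.nonterminal_input_mem)
      obtain (⟨f, hf, rfl⟩ | ⟨r₀, hr₀, p', q', z, hz, rfl⟩) | ⟨s, -, p', hs, rfl⟩ := hr
      · cases hrw with
        | head =>
          obtain ⟨y, hy, hm⟩ := exists_tripleMatch_of_derives hd
          obtain ⟨hK, rfl, hx⟩ := hm.of_terminals rfl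
          exact ⟨y, hy, hf, hK, hx⟩
        | cons _ h => cases h
      · simp at hin
      · simp at hin
  · rintro ⟨y, hy, hM, hK, rfl⟩
    obtain ⟨z, hz, hd⟩ := exists_triplePath_derives_output (M := M) (out := out) M.start y hK
      (mem_relevantSymbols_of_derives hy)
    have hp : (G.tripleGrammar M K out).Produces [.nonterminal none]
        [.nonterminal (some (M.start, .nonterminal G.initial, M.eval y))] :=
      produces_tripleGrammar_iff.2 ⟨_, .inl (.inl ⟨M.eval y, hM, rfl⟩), .head []⟩
    exact hp.trans_derives ((derives_of_triplePath hy hz).trans hd)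

end Transduction

end ContextFreeGrammar

open scoped Classical in
/-- The automaton that ignores the symbols outside `W` and otherwise runs `M`. -/
noncomputable def DFA.ignoreCompl {α σ : Type*} (M : DFA α σ) (W : Set α) : DFA α σ where
  step p a := if a ∈ W then M.step p a else p
  start := M.start
  accept := M.accept

lemma DFA.evalFrom_ignoreCompl {α σ : Type*} (M : DFA α σ) (W : Set α) (p : σ) (y : List α) :
    (M.ignoreCompl W).evalFrom p y = M.evalFrom p (projOn W y) := by
  induction y generalizing p with
  | nil => rfl
  | cons a y ih =>
    by_cases ha : a ∈ W <;> simp_all [projOn, DFA.ignoreCompl]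

lemma DFA.mem_accepts_ignoreCompl {α σ : Type*} (M : DFA α σ) (W : Set α) (y : List α) :
    y ∈ (M.ignoreCompl W).accepts ↔ projOn W y ∈ M.accepts := by
  simp only [DFA.mem_accepts, DFA.eval, DFA.evalFrom_ignoreCompl]
  rfl

lemma projT_eq_flatMap {T N : Type*} (y : List (Symbol T N)) :
    projT y = y.flatMap fun s => projT [s] := by
  induction y with
  | nil => rfl
  | cons s y ih =>
    rw [List.flatMap_cons, ← ih]
    cases s <;> rfl

/-- For any context-free grammar `G`, any subalphabet `W` of its total
alphabet, and any regular final language `F ⊆ W*`, the language `L(G,F)` of `G`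
finalized by `F` is context-free. -/
theorem finalized_by_regular_isContextFree {T : Type} (G : ContextFreeGrammar T)
    (W : Set (Symbol T G.NT)) (F : Language (Symbol T G.NT))
    (hFW : ∀ x ∈ F, ∀ s ∈ x, s ∈ W) (hF : F.IsRegular) :
    (finalizedLanguage G W F).IsContextFree := by
  obtain ⟨σ, _, M, rfl⟩ := hF
  refine ⟨G.tripleGrammar (M.ignoreCompl W) {s | s ∈ W ∨ ∃ t, s = .terminal t}
    (fun s => projT [s]), ?_⟩
  ext x
  rw [ContextFreeGrammar.mem_language_tripleGrammar_iff]
  simp only [DFA.mem_accepts_ignoreCompl, ← projT_eq_flatMap]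
  rfl
end

section
/- The family CF_REG of languages of the form L(G,F), where G is a context-free grammar and F is a regular final language, equals the family CF of context-free languages: a language L is context-free if and only if L = L(G,F) for some context-free grammar G and regular language F over some subalphabet W of the total alphabet of G. -/
/-- One step of a deterministic automaton that ignores the symbols outside `W`. -/
noncomputable def DFA.stepOn {α σ : Type*} (M : DFA α σ) (W : Set α) (p : σ) (a : α) : σ :=
  M.evalFrom p (projOn W [a])

namespace ContextFreeGrammar

/-- `Threads M W p u q v` means that `v` arises from `u` by guessing a run of `M` from `p` to `q`,
where the run reads the symbols of `W`. Each nonterminal `A` is either replaced by a triple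
recording the states around it, or, if it lies in `W`, it is erased and read by `M` directly. -/
inductive Threads {T N σ : Type*} (M : DFA (Symbol T N) σ) (W : Set (Symbol T N)) :
    σ → List (Symbol T N) → σ → List (Symbol T (Option (σ × N × σ))) → Prop
  | nil (p : σ) : Threads M W p [] p []
  | terminal {p q : σ} {t : T} {u : List (Symbol T N)}
      {v : List (Symbol T (Option (σ × N × σ)))}
      (h : Threads M W (M.stepOn W p (.terminal t)) u q v) :
      Threads M W p (.terminal t :: u) q (.terminal t :: v)
  | triple {p q : σ} (r : σ) {A : N} {u : List (Symbol T N)}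
      {v : List (Symbol T (Option (σ × N × σ)))}
      (h : Threads M W r u q v) :
      Threads M W p (.nonterminal A :: u) q (.nonterminal (some (p, A, r)) :: v)
  | erase {p q : σ} {A : N} {u : List (Symbol T N)}
      {v : List (Symbol T (Option (σ × N × σ)))}
      (hA : Symbol.nonterminal A ∈ W)
      (h : Threads M W (M.stepOn W p (.nonterminal A)) u q v) :
      Threads M W p (.nonterminal A :: u) q v

namespace Threads

variable {T N σ : Type*} {M : DFA (Symbol T N) σ} {W : Set (Symbol T N)} {p q : σ}
  {u u₁ u₂ : List (Symbol T N)} {v v₁ v₂ : List (Symbol T (Option (σ × N × σ)))}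

lemma append {r : σ} (h₁ : Threads M W p u₁ r v₁) (h₂ : Threads M W r u₂ q v₂) :
    Threads M W p (u₁ ++ u₂) q (v₁ ++ v₂) := by
  induction h₁ with
  | nil => exact h₂
  | terminal _ ih => exact .terminal (ih h₂)
  | triple s _ ih => exact .triple s (ih h₂)
  | erase hA _ ih => exact .erase hA (ih h₂)

lemma exists_of_append_left (h : Threads M W p (u₁ ++ u₂) q v) :
    ∃ r v₁ v₂, v = v₁ ++ v₂ ∧ Threads M W p u₁ r v₁ ∧ Threads M W r u₂ q v₂ := by
  induction u₁ generalizing p v with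
  | nil => exact ⟨p, [], v, rfl, .nil p, h⟩
  | cons a u₁ ih =>
    cases h with
    | terminal h =>
      obtain ⟨r, v₁, v₂, rfl, h₁, h₂⟩ := ih h
      exact ⟨r, _, v₂, rfl, .terminal h₁, h₂⟩
    | triple s h =>
      obtain ⟨r, v₁, v₂, rfl, h₁, h₂⟩ := ih h
      exact ⟨r, _, v₂, rfl, .triple s h₁, h₂⟩
    | erase hA h =>
      obtain ⟨r, v₁, v₂, rfl, h₁, h₂⟩ := ih h
      exact ⟨r, _, v₂, rfl, .erase hA h₁, h₂⟩

lemma exists_of_append_right (h : Threads M W p u q (v₁ ++ v₂)) :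
    ∃ r u₁ u₂, u = u₁ ++ u₂ ∧ Threads M W p u₁ r v₁ ∧ Threads M W r u₂ q v₂ := by
  induction u generalizing p v₁ with
  | nil =>
    generalize hv : v₁ ++ v₂ = v at h
    cases h
    obtain ⟨rfl, rfl⟩ := List.append_eq_nil_iff.mp hv
    exact ⟨_, [], [], rfl, .nil _, .nil _⟩
  | cons a u ih =>
    rcases v₁ with _ | ⟨b, v₁⟩
    · exact ⟨p, [], a :: u, rfl, .nil p, h⟩
    · generalize hv : b :: v₁ ++ v₂ = v at h
      cases h with
      | terminal h =>
        obtain ⟨rfl, rfl⟩ := List.cons.inj hv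
        obtain ⟨r, u₁, u₂, rfl, h₁, h₂⟩ := ih h
        exact ⟨r, _, u₂, rfl, .terminal h₁, h₂⟩
      | triple s h =>
        obtain ⟨rfl, rfl⟩ := List.cons.inj hv
        obtain ⟨r, u₁, u₂, rfl, h₁, h₂⟩ := ih h
        exact ⟨r, _, u₂, rfl, .triple s h₁, h₂⟩
      | erase hA h =>
        obtain ⟨r, u₁, u₂, rfl, h₁, h₂⟩ := ih (hv ▸ h)
        exact ⟨r, _, u₂, rfl, .erase hA h₁, h₂⟩

lemma exists_of_cons_nonterminal {X : Option (σ × N × σ)}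
    (h : Threads M W p u q (.nonterminal X :: v)) :
    ∃ p' A r u₁ u₂, X = some (p', A, r) ∧ u = u₁ ++ .nonterminal A :: u₂ ∧
      Threads M W p u₁ p' [] ∧ Threads M W r u₂ q v := by
  induction u generalizing p with
  | nil => cases h
  | cons a u ih =>
    cases h with
    | triple s h => exact ⟨p, _, s, [], u, rfl, rfl, .nil p, h⟩
    | erase hA h =>
      obtain ⟨p', A, r, u₁, u₂, rfl, rfl, h₁, h₂⟩ := ih h
      exact ⟨p', A, r, _, u₂, rfl, rfl, .erase hA h₁, h₂⟩

lemma finite_setOf [Finite σ] (M : DFA (Symbol T N) σ) (W : Set (Symbol T N))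
    (p : σ) (u : List (Symbol T N)) (q : σ) : {v | Threads M W p u q v}.Finite := by
  induction u generalizing p with
  | nil =>
    refine (Set.finite_singleton []).subset ?_
    rintro v (_ | _)
    rfl
  | cons a u ih =>
    refine (((ih (M.stepOn W p a)).union
      ((Set.finite_iUnion fun r => (ih r).image fun v =>
        match a with
        | .terminal t => .terminal t :: v
        | .nonterminal A => .nonterminal (some (p, A, r)) :: v))).subset ?_)
    intro v h
    cases h with
    | @terminal _ _ t _ v h =>
      exact .inr (Set.mem_iUnion.mpr ⟨_, v, h, rfl⟩)
    | @triple _ _ s A _ v h => exact .inr (Set.mem_iUnion.mpr ⟨s, v, h, rfl⟩)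
    | erase hA h => exact .inl h

lemma map_terminal_iff {w : List T} :
    Threads M W p u q (w.map .terminal) ↔
      M.evalFrom p (projOn W u) = q ∧ (∀ s ∈ u, s ∈ W ∨ ∃ t, s = .terminal t) ∧ w = projT u := by
  have eval_cons (p : σ) (a : Symbol T N) (u : List (Symbol T N)) :
      M.evalFrom p (projOn W (a :: u)) = M.evalFrom (M.stepOn W p a) (projOn W u) := by
    rw [DFA.stepOn, ← DFA.evalFrom_of_append]
    simp only [projOn, ← List.filter_append, List.singleton_append]
  induction u generalizing p w with
  | nil =>
    constructor
    · intro h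
      generalize hv : w.map Symbol.terminal = v at h
      cases h
      simp_all [projOn, projT]
    · rintro ⟨rfl, -, rfl⟩
      exact .nil p
  | cons a u ih =>
    rw [eval_cons]
    constructor
    · intro h
      generalize hv : w.map Symbol.terminal = v at h
      cases h with
      | @terminal _ _ t _ v h =>
        obtain ⟨t', w, rfl, ht, rfl⟩ := List.map_eq_cons_iff.mp hv
        obtain ⟨h₁, h₂, rfl⟩ := ih.mp h
        cases ht
        exact ⟨h₁, by simpa using h₂, rfl⟩
      | triple s h => simp [List.map_eq_cons_iff] at hv
      | erase hA h =>
        obtain ⟨h₁, h₂, rfl⟩ := ih.mp (hv ▸ h)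
        exact ⟨h₁, List.forall_mem_cons.mpr ⟨.inl hA, h₂⟩, rfl⟩
    · rintro ⟨h₁, h₂, rfl⟩
      obtain ⟨ha, h₂⟩ := List.forall_mem_cons.mp h₂
      have h := ih.mpr ⟨h₁, h₂, rfl⟩
      cases a with
      | terminal t => exact .terminal h
      | nonterminal A => exact .erase (by simpa using ha) h

end Threads

variable {T : Type*} {G : ContextFreeGrammar T} {σ : Type}
  {M : DFA (Symbol T G.NT) σ} {W : Set (Symbol T G.NT)}

/-- The rules of `ContextFreeGrammar.threaded`. -/
def threadedRules (G : ContextFreeGrammar T) (M : DFA (Symbol T G.NT) σ)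
    (W : Set (Symbol T G.NT)) : Set (ContextFreeRule T (Option (σ × G.NT × σ))) :=
  (⋃ q ∈ M.accept, ContextFreeRule.mk none ''
    {v | Threads M W M.start [.nonterminal G.initial] q v}) ∪
  ⋃ r ∈ G.rules, ⋃ p, ⋃ q, ContextFreeRule.mk (some (p, r.input, q)) ''
    {v | Threads M W p r.output q v}

lemma finite_threadedRules [Finite σ] (G : ContextFreeGrammar T) (M : DFA (Symbol T G.NT) σ)
    (W : Set (Symbol T G.NT)) : (G.threadedRules M W).Finite :=
  ((Set.toFinite M.accept).biUnion fun q _ => (Threads.finite_setOf M W _ _ q).image _).union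
    (G.rules.finite_toSet.biUnion fun r _ => Set.finite_iUnion fun p => Set.finite_iUnion fun q =>
      (Threads.finite_setOf M W p r.output q).image _)

/-- The triple construction: a grammar that simulates `G` together with a run of `M` on the
symbols of `W` in a sentential form, and that erases the remaining nonterminals. -/
noncomputable def threaded [Finite σ] (G : ContextFreeGrammar T) (M : DFA (Symbol T G.NT) σ)
    (W : Set (Symbol T G.NT)) : ContextFreeGrammar T where
  NT := Option (σ × G.NT × σ)
  initial := none
  rules := (G.finite_threadedRules M W).toFinset

variable [Finite σ]

lemma mem_threaded_rules {r : ContextFreeRule T (Option (σ × G.NT × σ))} :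
    r ∈ (G.threaded M W).rules ↔ r ∈ G.threadedRules M W :=
  Set.Finite.mem_toFinset _

lemma mk_none_mem_threaded_rules {v : List (Symbol T (Option (σ × G.NT × σ)))} :
    ContextFreeRule.mk none v ∈ (G.threaded M W).rules ↔
      ∃ q ∈ M.accept, Threads M W M.start [.nonterminal G.initial] q v := by
  rw [mem_threaded_rules]
  simp [threadedRules]

lemma mk_some_mem_threaded_rules {p q : σ} {A : G.NT}
    {v : List (Symbol T (Option (σ × G.NT × σ)))} :
    ContextFreeRule.mk (some (p, A, q)) v ∈ (G.threaded M W).rules ↔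
      ∃ u, ContextFreeRule.mk A u ∈ G.rules ∧ Threads M W p u q v := by
  rw [mem_threaded_rules]
  simp only [threadedRules, Set.mem_union, Set.mem_iUnion, Set.mem_image, Set.mem_ofPred_eq]
  constructor
  · rintro (⟨_, _, _, _, h⟩ | ⟨⟨B, u⟩, hr, p', q', v', hv, h⟩)
    · cases h
    · cases h
      exact ⟨u, hr, hv⟩
  · rintro ⟨u, hr, hv⟩
    exact .inr ⟨_, hr, p, q, v, hv, rfl⟩

lemma Derives.exists_threads {u y : List (Symbol T G.NT)} {p q : σ} {w : List T}
    (h : G.Derives u y) (hy : Threads M W p y q (w.map .terminal)) :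
    ∃ v, Threads M W p u q v ∧ (G.threaded M W).Derives v (w.map .terminal) := by
  induction h using Relation.ReflTransGen.head_induction_on with
  | refl => exact ⟨_, hy, .refl _⟩
  | head h _ ih =>
    obtain ⟨⟨A, z⟩, hr, h⟩ := h
    obtain ⟨a, b, rfl, rfl⟩ := h.exists_parts
    obtain ⟨v, hv, hd⟩ := ih
    obtain ⟨q', v', v₃, rfl, h', h₃⟩ := hv.exists_of_append_left
    obtain ⟨p', v₁, v₂, rfl, h₁, h₂⟩ := h'.exists_of_append_left
    refine ⟨v₁ ++ [.nonterminal (some (p', A, q'))] ++ v₃,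
      (h₁.append (.triple q' (.nil q'))).append h₃, .head ?_ hd⟩
    exact ⟨_, mk_some_mem_threaded_rules.mpr ⟨z, hr, h₂⟩,
      ContextFreeRule.rewrites_of_exists_parts _ _ _⟩

lemma Derives.exists_of_threads {u : List (Symbol T G.NT)} {p q : σ} {w : List T}
    {v : List (Symbol T (Option (σ × G.NT × σ)))}
    (h : (G.threaded M W).Derives v (w.map .terminal)) (hv : Threads M W p u q v) :
    ∃ y, G.Derives u y ∧ Threads M W p y q (w.map .terminal) := by
  induction h using Relation.ReflTransGen.head_induction_on generalizing u with
  | refl => exact ⟨u, .refl _, hv⟩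
  | head h _ ih =>
    obtain ⟨⟨X, z⟩, hr, h⟩ := h
    obtain ⟨a, b, rfl, rfl⟩ := h.exists_parts
    rw [List.append_assoc] at hv
    obtain ⟨s, u₁, u', rfl, h₁, h'⟩ := hv.exists_of_append_right
    obtain ⟨p', A, q', u₂, u₃, rfl, rfl, h₂, h₃⟩ := h'.exists_of_cons_nonterminal
    obtain ⟨x, hx, hxz⟩ := mk_some_mem_threaded_rules.mp hr
    have h₁₂ := h₁.append h₂
    erw [List.append_nil] at h₁₂
    obtain ⟨y, hd, hy⟩ := ih ((h₁₂.append hxz).append h₃)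
    refine ⟨y, .head ⟨_, hx, ?_⟩ hd, hy⟩
    simpa using ContextFreeRule.rewrites_of_exists_parts ⟨A, x⟩ (u₁ ++ u₂) u₃

theorem language_threaded (G : ContextFreeGrammar T) (M : DFA (Symbol T G.NT) σ)
    (W : Set (Symbol T G.NT)) :
    (G.threaded M W).language = finalizedLanguage G W M.accepts := by
  ext w
  constructor
  · intro h
    rcases Derives.eq_or_head h with h | ⟨v, ⟨⟨X, z⟩, hr, h⟩, hd⟩
    · cases w <;> simp at h
    · obtain ⟨a, b, hab, rfl⟩ := h.exists_parts
      obtain ⟨rfl, rfl, rfl⟩ : a = [] ∧ b = [] ∧ X = none := by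
        rcases a with _ | ⟨_, a⟩
        · simp only [List.nil_append, List.singleton_append, List.cons.injEq,
            Symbol.nonterminal.injEq] at hab
          exact ⟨rfl, hab.2.symm, hab.1.symm⟩
        · simp at hab
      obtain ⟨q, hq, hz⟩ := mk_none_mem_threaded_rules.mp hr
      simp only [List.nil_append, List.append_nil] at hd
      obtain ⟨y, hy, hyw⟩ := hd.exists_of_threads hz
      obtain ⟨rfl, hyW, hw⟩ := Threads.map_terminal_iff.mp hyw
      exact ⟨y, hy, hq, hyW, hw⟩
  · rintro ⟨y, hy, hq, hyW, hw⟩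
    obtain ⟨v, hv, hd⟩ := Derives.exists_threads hy
      (Threads.map_terminal_iff (M := M) (W := W).mpr ⟨rfl, hyW, hw⟩)
    refine .head ⟨_, mk_none_mem_threaded_rules.mpr ⟨_, hq, hv⟩, ?_⟩ hd
    exact ContextFreeRule.Rewrites.input_output

theorem language_eq_finalizedLanguage (G : ContextFreeGrammar T) :
    G.language = finalizedLanguage G ∅ 1 := by
  ext w
  constructor
  · intro h
    refine ⟨w.map .terminal, h, by simp [projOn, Language.mem_one], by simp, ?_⟩
    simp [projT, List.filterMap_map]
  · rintro ⟨y, hy, -, hyT, rfl⟩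
    have : (projT y).map .terminal = y := by
      clear hy
      induction y with
      | nil => rfl
      | cons a y ih =>
        obtain ⟨ha, hy⟩ := List.forall_mem_cons.mp hyT
        obtain ⟨t, rfl⟩ := ha.resolve_left (Set.notMem_empty _)
        exact congrArg (_ :: ·) (ih hy)
    rw [mem_language_iff, this]
    exact hy

end ContextFreeGrammar

lemma Language.isRegular_one {α : Type*} : (1 : Language α).IsRegular := by
  refine ⟨Bool, inferInstance, ⟨fun _ _ => false, true, {true}⟩, ?_⟩
  ext w
  induction w using List.reverseRecOn with
  | nil => simp [DFA.mem_accepts, Language.mem_one]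
  | append_singleton w a => simp [DFA.mem_accepts, Language.mem_one]

/-- `CF_REG = CF`.  A language `L` is context-free if and only if
`L = L(G,F)` for some context-free grammar `G` and some regular language `F`
over a subalphabet `W` of the total alphabet of `G`. -/
theorem isContextFree_iff_finalized_by_regular {T : Type} (L : Language T) :
    L.IsContextFree ↔
      ∃ (G : ContextFreeGrammar T) (W : Set (Symbol T G.NT))
        (F : Language (Symbol T G.NT)),
          (∀ x ∈ F, ∀ s ∈ x, s ∈ W) ∧ F.IsRegular ∧ L = finalizedLanguage G W F := by
  constructor
  · rintro ⟨G, rfl⟩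
    refine ⟨G, ∅, 1, ?_, Language.isRegular_one, G.language_eq_finalizedLanguage⟩
    rintro x hx s hs
    rw [Language.mem_one] at hx
    simp [hx] at hs
  · rintro ⟨G, W, F, -, ⟨σ, _, M, rfl⟩, rfl⟩
    exact ⟨G.threaded M W, G.language_threaded M W⟩
end

section
/- For every left-extended queue grammar H, there exists a left-extended queue grammar Q = (V, T, U, D, s, R) such that L(H) = L(Q) and every rule (a, b, x, c) ∈ R satisfies a ∈ V − T, b ∈ U − D, x ∈ (V − T)* ∪ T*, and c ∈ U. -/
/-- A left-extended queue grammar `Q = (V, T, U, D, s, P)` with terminal alphabet `T`.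
The total alphabet is `V = T ⊕ N`, where `N` is the (finite) type of symbols of `V − T`,
and `U` is a second (finite) alphabet, automatically disjoint from `V`, with `D ⊆ U`.
The start string `s ∈ (V−T)(U−D)` is recorded by `startN` and `startU`.
`P ⊆ (V × (U−D)) × (V* × U)` is a finite relation. -/
structure LEQueueGrammar (T : Type) where
  /-- the symbols of `V − T` -/
  N : Type
  /-- the alphabet `U` -/
  U : Type
  finN : Finite N
  finU : Finite U
  /-- `D ⊆ U` -/
  D : Set U
  startN : N
  startU : U
  startU_not_mem : startU ∉ D
  /-- the finite relation `P ⊆ (V × (U−D)) × (V* × U)` -/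
  P : Set ((T ⊕ N) × U × List (T ⊕ N) × U)
  finP : P.Finite
  mem_P : ∀ p ∈ P, p.2.1 ∉ D

namespace LEQueueGrammar

variable {T : Type}

/-- One derivation step of a left-extended queue grammar.  A configuration
`(w, r, b)` stands for the string `w#rb ∈ V*{#}V*U`; the step
`w#arb ⇒ wa#rzc` is licensed by a rule `(a, b, z, c) ∈ P`. -/
def Step (g : LEQueueGrammar T) :
    List (T ⊕ g.N) × List (T ⊕ g.N) × g.U →
    List (T ⊕ g.N) × List (T ⊕ g.N) × g.U → Prop :=
  fun c₁ c₂ => ∃ (w r z : List (T ⊕ g.N)) (a : T ⊕ g.N) (b c : g.U),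
    (a, b, z, c) ∈ g.P ∧ c₁ = (w, a :: r, b) ∧ c₂ = (w ++ [a], r ++ z, c)

/-- `L(Q) = {v ∈ T* : #s ⇒* w#vf for some w ∈ V* and f ∈ D}`. -/
def language (g : LEQueueGrammar T) : Language T :=
  { v | ∃ (w : List (T ⊕ g.N)) (f : g.U), f ∈ g.D ∧
      Relation.ReflTransGen g.Step ([], [Sum.inr g.startN], g.startU)
        (w, v.map Sum.inl, f) }

end LEQueueGrammar

namespace LEQueueGrammar

variable {T : Type} (H : LEQueueGrammar T)

/-- The symbols that can be consumed from the queue: the start symbol and the left-hand sides of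
rules. They serve as the nonterminals of the normalized grammar. -/
abbrev ReadSymbol : Type :=
  {x : T ⊕ H.N // x = Sum.inr H.startN ∨ ∃ p ∈ H.P, p.1 = x}

/-- The terminal words that are suffixes of right-hand sides, together with the empty word. The
normalized grammar keeps such a word in its state until it can be emitted. -/
abbrev Pending : Type :=
  {y : List T // y = [] ∨ ∃ p ∈ H.P, y.map Sum.inl <:+ p.2.2.1}

instance : Finite H.ReadSymbol := by
  refine Set.Finite.to_subtype
    (((H.finP.image Prod.fst).insert (Sum.inr H.startN)).subset ?_)
  intro x hx
  exact hx

instance : Finite H.Pending := by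
  have hinj : Function.Injective (List.map (Sum.inl : T → T ⊕ H.N)) :=
    List.map_injective_iff.2 Sum.inl_injective
  refine Set.Finite.to_subtype (((H.finP.biUnion fun p _ =>
    (List.finite_toSet p.2.2.1.tails).preimage hinj.injOn).insert []).subset ?_)
  rintro y (rfl | ⟨p, hp, hy⟩)
  · exact Set.mem_insert _ _
  · refine Set.mem_insert_of_mem _ (Set.mem_biUnion hp ?_)
    simpa using hy

/-- The empty pending word. -/
def Pending.empty : H.Pending := ⟨[], Or.inl rfl⟩

/-- Rules that append a word of nonterminals and store a terminal suffix in the state. -/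
def readRules : Set ((T ⊕ H.ReadSymbol) × (H.U × H.Pending) ×
    List (T ⊕ H.ReadSymbol) × (H.U × H.Pending)) :=
  {p | ∃ (n : H.ReadSymbol) (b : H.U) (l : List H.ReadSymbol) (c : H.U) (y : H.Pending),
    (n.1, b, l.map Subtype.val ++ y.1.map Sum.inl, c) ∈ H.P ∧
    p = (Sum.inr n, (b, Pending.empty H), l.map Sum.inr, (c, y))}

/-- Rules that append a word of terminals, emitting the word stored in the state first. -/
def emitRules : Set ((T ⊕ H.ReadSymbol) × (H.U × H.Pending) ×
    List (T ⊕ H.ReadSymbol) × (H.U × H.Pending)) :=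
  {p | ∃ (n : H.ReadSymbol) (b : H.U) (t : List T) (c : H.U) (y : H.Pending),
    (n.1, b, t.map Sum.inl, c) ∈ H.P ∧
    p = (Sum.inr n, (b, y), (y.1 ++ t).map Sum.inl, (c, Pending.empty H))}

theorem finite_readRules : H.readRules.Finite := by
  have := H.finU
  have hinj : Function.Injective (List.map (Subtype.val : H.ReadSymbol → T ⊕ H.N)) :=
    List.map_injective_iff.2 Subtype.val_injective
  have hX := (H.finP.biUnion fun p _ =>
    (List.finite_toSet p.2.2.1.inits).preimage hinj.injOn).image
      (List.map (Sum.inr : H.ReadSymbol → T ⊕ H.ReadSymbol))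
  refine (((Set.finite_range (Sum.inr : H.ReadSymbol → T ⊕ H.ReadSymbol)).prod
    (Set.finite_univ.prod (hX.prod Set.finite_univ)))).subset ?_
  rintro _ ⟨n, b, l, c, y, h, rfl⟩
  refine ⟨⟨n, rfl⟩, Set.mem_univ _, ⟨l, Set.mem_biUnion h ?_, rfl⟩, Set.mem_univ _⟩
  exact (List.mem_inits _ _).2 (List.prefix_append _ _)

theorem finite_emitRules : H.emitRules.Finite := by
  have := H.finU
  have hinj : Function.Injective (List.map (Sum.inl : T → T ⊕ H.N)) :=
    List.map_injective_iff.2 Sum.inl_injective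
  have hX := Set.Finite.image2
    (fun (y : H.Pending) t => (y.1 ++ t).map (Sum.inl : T → T ⊕ H.ReadSymbol))
    Set.finite_univ ((H.finP.image fun p => p.2.2.1).preimage hinj.injOn)
  refine (((Set.finite_range (Sum.inr : H.ReadSymbol → T ⊕ H.ReadSymbol)).prod
    (Set.finite_univ.prod (hX.prod Set.finite_univ)))).subset ?_
  rintro _ ⟨n, b, t, c, y, h, rfl⟩
  exact ⟨⟨n, rfl⟩, Set.mem_univ _, ⟨y, Set.mem_univ _, t, ⟨_, h, rfl⟩, rfl⟩, Set.mem_univ _⟩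

/-- A grammar equivalent to `H` whose rules consume nonterminals and append either only
nonterminals or only terminals. -/
abbrev normalize : LEQueueGrammar T where
  N := H.ReadSymbol
  U := H.U × H.Pending
  finN := inferInstance
  finU := have := H.finU; inferInstance
  D := {u | u.1 ∈ H.D ∧ u.2 = Pending.empty H}
  startN := ⟨Sum.inr H.startN, Or.inl rfl⟩
  startU := (H.startU, Pending.empty H)
  startU_not_mem h := H.startU_not_mem h.1
  P := H.readRules ∪ H.emitRules
  finP := H.finite_readRules.union H.finite_emitRules
  mem_P := by
    rintro _ (⟨n, b, l, c, y, h, rfl⟩ | ⟨n, b, t, c, y, h, rfl⟩) hD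
    · exact H.mem_P _ h hD.1
    · exact H.mem_P _ h hD.1

/-- The symbol of `H` represented by a symbol of `H.normalize`. -/
def decode : T ⊕ H.ReadSymbol → T ⊕ H.N := Sum.elim Sum.inl Subtype.val

theorem map_decode_map_inl (t : List T) :
    (t.map Sum.inl).map H.decode = t.map Sum.inl := by
  rw [List.map_map]; rfl

theorem map_decode_map_inr (l : List H.ReadSymbol) :
    (l.map Sum.inr).map H.decode = l.map Subtype.val := by
  rw [List.map_map]; rfl

/-- The configuration of `H` represented by a configuration of `H.normalize`: the pending word
is moved to the end of the queue. -/
def decodeConfig (c : List (T ⊕ H.ReadSymbol) × List (T ⊕ H.ReadSymbol) × (H.U × H.Pending)) :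
    List (T ⊕ H.N) × List (T ⊕ H.N) × H.U :=
  (c.1.map H.decode, c.2.1.map H.decode ++ c.2.2.2.1.map Sum.inl, c.2.2.1)

theorem Step.decodeConfig {c₁ c₂ : List (T ⊕ H.ReadSymbol) × List (T ⊕ H.ReadSymbol) ×
    (H.U × H.Pending)} (h : H.normalize.Step c₁ c₂) :
    H.Step (H.decodeConfig c₁) (H.decodeConfig c₂) := by
  obtain ⟨w, r, z, a, b, c, hP, rfl, rfl⟩ := h
  rcases hP with ⟨n, b, l, c, y, hP, heq⟩ | ⟨n, b, t, c, y, hP, heq⟩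
  all_goals cases heq
  · refine ⟨w.map H.decode, r.map H.decode, _, n.1, b, c, hP, ?_, ?_⟩
    · simp [LEQueueGrammar.decodeConfig, decode, Pending.empty]
    · simp only [LEQueueGrammar.decodeConfig, List.map_append, map_decode_map_inr,
        List.append_assoc]
      rfl
  · refine ⟨w.map H.decode, r.map H.decode ++ y.1.map Sum.inl, _, n.1, b, c, hP, ?_, ?_⟩
    · simp [LEQueueGrammar.decodeConfig, decode]
    · simp only [LEQueueGrammar.decodeConfig, List.map_append, map_decode_map_inl,
        List.append_assoc, Pending.empty, List.map_nil, List.append_nil]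
      rfl

theorem language_normalize_le : H.normalize.language ≤ H.language := by
  rintro v ⟨w, ⟨f, y⟩, ⟨hf, hy⟩, h⟩
  obtain rfl : y = Pending.empty H := hy
  refine ⟨w.map H.decode, f, hf, ?_⟩
  have := h.lift H.decodeConfig fun _ _ => Step.decodeConfig H
  simpa [Function.onFun, LEQueueGrammar.decodeConfig, map_decode_map_inl, Pending.empty, decode]
    using this

theorem step_read (w r : List (T ⊕ H.ReadSymbol)) {n : H.ReadSymbol} {b c : H.U}
    {l : List H.ReadSymbol} {y : H.Pending}
    (h : (n.1, b, l.map Subtype.val ++ y.1.map Sum.inl, c) ∈ H.P) :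
    H.normalize.Step (w, Sum.inr n :: r, (b, Pending.empty H))
      (w ++ [Sum.inr n], r ++ l.map Sum.inr, (c, y)) :=
  ⟨w, r, _, _, _, _, Or.inl ⟨n, b, l, c, y, h, rfl⟩, rfl, rfl⟩

theorem step_emit (w r : List (T ⊕ H.ReadSymbol)) {n : H.ReadSymbol} {b c : H.U}
    {t : List T} (y : H.Pending) (h : (n.1, b, t.map Sum.inl, c) ∈ H.P) :
    H.normalize.Step (w, Sum.inr n :: r, (b, y))
      (w ++ [Sum.inr n], r ++ (y.1 ++ t).map Sum.inl, (c, Pending.empty H)) :=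
  ⟨w, r, _, _, _, _, Or.inr ⟨n, b, t, c, y, h, rfl⟩, rfl, rfl⟩

/-- `H.normalize` can finish with the word `v` from the queue `r` and the state `u`. -/
def Accepts (v : List T) (r : List (T ⊕ H.ReadSymbol)) (u : H.U × H.Pending) : Prop :=
  ∀ w, ∃ w', ∃ f ∈ H.normalize.D,
    Relation.ReflTransGen H.normalize.Step (w, r, u) (w', v.map Sum.inl, f)

variable {H}

theorem Accepts.read {v : List T} {r : List (T ⊕ H.ReadSymbol)} {n : H.ReadSymbol} {b c : H.U}
    {l : List H.ReadSymbol} {y : H.Pending}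
    (h : (n.1, b, l.map Subtype.val ++ y.1.map Sum.inl, c) ∈ H.P)
    (hv : H.Accepts v (r ++ l.map Sum.inr) (c, y)) :
    H.Accepts v (Sum.inr n :: r) (b, Pending.empty H) := fun w =>
  let ⟨w', f, hf, hr⟩ := hv (w ++ [Sum.inr n])
  ⟨w', f, hf, hr.head (H.step_read w r h)⟩

theorem Accepts.emit {v : List T} {r : List (T ⊕ H.ReadSymbol)} {n : H.ReadSymbol} {b c : H.U}
    {t : List T} {y : H.Pending} (h : (n.1, b, t.map Sum.inl, c) ∈ H.P)
    (hv : H.Accepts v (r ++ (y.1 ++ t).map Sum.inl) (c, Pending.empty H)) :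
    H.Accepts v (Sum.inr n :: r) (b, y) := fun w =>
  let ⟨w', f, hf, hr⟩ := hv (w ++ [Sum.inr n])
  ⟨w', f, hf, hr.head (H.step_emit w r y h)⟩

/-- Along a successful derivation of `H`, every queue splits into the symbols that will be
consumed and a terminal word that will survive, and the latter may be kept pending as long as
there is something left to consume. -/
theorem exists_accepts {v : List T} {w : List (T ⊕ H.N)} {f : H.U} (hf : f ∈ H.D)
    {c : List (T ⊕ H.N) × List (T ⊕ H.N) × H.U}
    (h : Relation.ReflTransGen H.Step c (w, v.map Sum.inl, f)) :
    ∃ (l : List H.ReadSymbol) (t : List T),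
      c.2.1 = l.map Subtype.val ++ t.map Sum.inl ∧
      H.Accepts v (l.map Sum.inr ++ t.map Sum.inl) (c.2.2, Pending.empty H) ∧
      (l ≠ [] → ∀ y : H.Pending, y.1 = t → H.Accepts v (l.map Sum.inr) (c.2.2, y)) := by
  induction h using Relation.ReflTransGen.head_induction_on with
  | refl => exact ⟨[], v, rfl, fun w => ⟨w, _, ⟨hf, rfl⟩, .refl⟩, fun h => absurd rfl h⟩
  | head hstep _ ih =>
    obtain ⟨w, r, z, a, b, c, hP, rfl, rfl⟩ := hstep
    obtain ⟨l', t', heq, hA, hB⟩ := ih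
    dsimp only at heq hA hB ⊢
    let n : H.ReadSymbol := ⟨a, Or.inr ⟨_, hP, rfl⟩⟩
    rcases List.append_eq_append_iff.1 heq with ⟨m, hl, rfl⟩ | ⟨m, rfl, ht⟩
    · obtain ⟨l, l₁, rfl, rfl, rfl⟩ := List.map_eq_append_iff.1 hl
      have key : H.Accepts v (Sum.inr n :: l.map Sum.inr) (b, Pending.empty H) := by
        rcases eq_or_ne l₁ [] with rfl | hl₁
        · refine Accepts.emit (t := t') (c := c) hP ?_
          simpa [Pending.empty] using hA
        · let y : H.Pending := ⟨t', Or.inr ⟨_, hP, List.suffix_append _ _⟩⟩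
          refine Accepts.read (y := y) (c := c) hP ?_
          simpa using hB (by simp [hl₁]) y rfl
      refine ⟨n :: l, [], by simp [n], by simpa using key, ?_⟩
      rintro - y hy
      obtain rfl : y = Pending.empty H := Subtype.ext hy
      simpa using key
    · obtain ⟨x, t, rfl, rfl, rfl⟩ := List.map_eq_append_iff.1 ht
      refine ⟨n :: l', x, by simp [n], ?_, ?_⟩
      · refine Accepts.emit (t := t) (c := c) hP ?_
        simpa [Pending.empty] using hA
      · rintro - y rfl
        refine Accepts.emit (t := t) (c := c) hP ?_
        simpa using hA

theorem language_le_normalize : H.language ≤ H.normalize.language := by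
  rintro v ⟨w, f, hf, h⟩
  obtain ⟨l, t, heq, hA, -⟩ := exists_accepts hf h
  dsimp only at heq hA
  match l, heq, hA with
  | [], heq, _ => cases t <;> simp at heq
  | n :: l, heq, hA =>
    simp only [List.map_cons, List.cons_append, List.cons.injEq, List.nil_eq,
      List.append_eq_nil_iff, List.map_eq_nil_iff] at heq
    obtain ⟨hn, rfl, rfl⟩ := heq
    obtain rfl : n = H.normalize.startN := Subtype.ext hn.symm
    obtain ⟨w', f', hf', hr⟩ := hA []
    exact ⟨w', f', hf', hr⟩

end LEQueueGrammar

/-- For every left-extended queue grammar `H`, there exists a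
left-extended queue grammar `Q = (V, T, U, D, s, R)` with `L(H) = L(Q)` such that
every rule `(a, b, x, c) ∈ R` satisfies `a ∈ V − T`, `b ∈ U − D`, and
`x ∈ (V − T)* ∪ T*` (and trivially `c ∈ U`). -/
theorem exists_normalized_leQueueGrammar {α : Type} (H : LEQueueGrammar α) :
    ∃ Q : LEQueueGrammar α, Q.language = H.language ∧
      ∀ p ∈ Q.P,
        (∃ n : Q.N, p.1 = Sum.inr n) ∧
        p.2.1 ∉ Q.D ∧
        ((∀ s ∈ p.2.2.1, ∃ n : Q.N, s = Sum.inr n) ∨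
         (∀ s ∈ p.2.2.1, ∃ t : α, s = Sum.inl t)) := by
  refine ⟨H.normalize, le_antisymm H.language_normalize_le
    LEQueueGrammar.language_le_normalize, fun p hp => ⟨?_, H.normalize.mem_P p hp, ?_⟩⟩
  · rcases hp with ⟨n, b, l, c, y, h, rfl⟩ | ⟨n, b, t, c, y, h, rfl⟩ <;> exact ⟨n, rfl⟩
  · rcases hp with ⟨n, b, l, c, y, h, rfl⟩ | ⟨n, b, t, c, y, h, rfl⟩
    · refine Or.inl fun s hs => ?_
      obtain ⟨m, -, rfl⟩ := List.mem_map.1 hs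
      exact ⟨m, rfl⟩
    · refine Or.inr fun s hs => ?_
      obtain ⟨m, -, rfl⟩ := List.mem_map.1 hs
      exact ⟨m, rfl⟩
end
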